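/- Let q ≥ 3 be a prime power, I an index set, η ∈ F_{q^2} with η^{q+1} = 1, and let 𝒫 be a good set, with associated parallelism Π_𝒫 of Σ_η. For every b ∈ F_{q^2}, let g_b be the projectivity of PG(3,q^2) induced by the linear map (x_1,x_2,x_3,x_4) ↦ (x_1 + b x_2, x_2, x_3 + b^q x_4, x_4). Then g_b maps Π_𝒫 to itself: { { g_b(m) : m ∈ S } : S ∈ Π_𝒫 } = Π_𝒫 (where g_b(m) denotes the image of the line m of Σ_η under g_b, pointwise). -/

import Mathlib

open Projectivization Classical

noncomputable section

abbrev Pt (F : Type) [Field F] := Projectivization F (Fin 4 → F)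

variable (q : ℕ) (F : Type) [Field F]

/-- The line `t₁ = {(x₁, x₂, 0, 0)}` of `PG(3, q²)`. -/
def t1 : Set (Pt F) := {P | P.rep 2 = 0 ∧ P.rep 3 = 0}

/-- The line `t₂ = {(0, 0, x₃, x₄)}` of `PG(3, q²)`. -/
def t2 : Set (Pt F) := {P | P.rep 0 = 0 ∧ P.rep 1 = 0}

/-- The line `r_{U₁} = {(x₁, 0, x₃, 0)}` of `PG(3, q²)`. -/
def rU1 : Set (Pt F) := {P | P.rep 1 = 0 ∧ P.rep 3 = 0}

/-- The Baer subgeometry `Σ_α = {(x, y, α xᑫ, α yᑫ)}`. -/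
def SigmaSet (α : F) : Set (Pt F) :=
  {P | ∃ (x y : F) (h : ![x, y, α * x ^ q, α * y ^ q] ≠ 0),
    P = Projectivization.mk F ![x, y, α * x ^ q, α * y ^ q] h}

def tauFun (α : F) (v : Fin 4 → F) : Fin 4 → F :=
  ![(v 2) ^ q, (v 3) ^ q, α ^ (q + 1) * (v 0) ^ q, α ^ (q + 1) * (v 1) ^ q]

/-- The collineation `τ_α : (x₁,x₂,x₃,x₄) ↦ (x₃ᑫ, x₄ᑫ, α^{q+1} x₁ᑫ, α^{q+1} x₂ᑫ)`. -/
def tau (α : F) (P : Pt F) : Pt F :=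
  if h : tauFun q F α P.rep ≠ 0 then Projectivization.mk F _ h else P

/-- `s` is (the point set of) a line of `PG(3, q²)`. -/
def isLine (s : Set (Pt F)) : Prop :=
  ∃ W : Submodule F (Fin 4 → F), Module.finrank F W = 2 ∧
    s = {P : Pt F | P.submodule ≤ W}

/-- `s` is (the point set of) a plane of `PG(3, q²)`. -/
def isPlane (s : Set (Pt F)) : Prop :=
  ∃ W : Submodule F (Fin 4 → F), Module.finrank F W = 3 ∧
    s = {P : Pt F | P.submodule ≤ W}

/-- The set of points of the line (or point) spanned by `A` and `B`. -/
def lineThrough (A B : Pt F) : Set (Pt F) :=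
  {P : Pt F | P.submodule ≤ A.submodule ⊔ B.submodule}

/-- For `P = (a, b, 0, 0) ∈ t₁`, `rLine P` is the line through `(a,b,0,0)` and `(0,0,aᑫ,bᑫ)`. -/
def rLine (P : Pt F) : Set (Pt F) := lineThrough F P (tau q F 1 P)

/-- The Desarguesian line-spread `D_α = { r_P ∩ Σ_α : P ∈ t₁ }`. -/
def Dspread (α : F) : Set (Set (Pt F)) :=
  {s | ∃ P ∈ t1 F, s = rLine q F P ∩ SigmaSet q F α}

/-- `U = { u : u^{q+1} = 1 }`. -/
def Uset : Set F := {u : F | u ^ (q + 1) = 1}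

/-- The subfield `F_q` of `F_{q²}`, as a set. -/
def FqSet : Set F := {x : F | x ^ q = x}

/-- The norm image `N = { α^{q+1} : α ∈ I }`. -/
def normIm (I : Set F) : Set F := (fun α : F => α ^ (q + 1)) '' I

/-- `I` is an index set. -/
def IsIndexSet (I : Set F) : Prop :=
  (0 : F) ∉ I ∧
  Set.InjOn (fun α : F => α ^ (q + 1)) I ∧
  (∀ a ∈ normIm q F I, a ∈ FqSet q F) ∧
  (1 : F) ∉ normIm q F I ∧
  normIm q F I ∪ Inv.inv '' normIm q F I ∪ {1} = FqSet q F \ {0} ∧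
  (Even q → normIm q F I ∩ Inv.inv '' normIm q F I = ∅) ∧
  (Odd q → normIm q F I ∩ Inv.inv '' normIm q F I = {-1} ∧
    normIm q F I ∩ Neg.neg '' normIm q F I = ∅)

lemma vec4_ne_zero_fst (a b c d : F) (ha : a ≠ 0) : ![a, b, c, d] ≠ 0 := by
  intro h
  exact ha (by simpa using congrFun h 0)

/-- The point `P_{αu} = (1, 0, αu, 0)`. -/
def Ppt (α u : F) : Pt F :=
  Projectivization.mk F ![1, 0, α * u, 0] (vec4_ne_zero_fst F 1 0 (α * u) 0 one_ne_zero)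

/-- The plane `π_{αv} : X₄ = α v X₂`. -/
def planeSet (α v : F) : Set (Pt F) := {P | P.rep 3 = α * v * P.rep 1}

/-- The Baer subpencil `p(P_{αu}, π_{αv})`: the lines through `P_{αu}` contained in `π_{αv}`
meeting `Σ_α` in `q+1` points. -/
def pencil (α u v : F) : Set (Set (Pt F)) :=
  {ℓ | isLine F ℓ ∧ Ppt F α u ∈ ℓ ∧ ℓ ⊆ planeSet F α v ∧ (ℓ ∩ SigmaSet q F α).ncard = q + 1}

/-- `m` is a line of the Baer subgeometry `Σ_η`. -/
def IsLineOfSigma (η : F) (m : Set (Pt F)) : Prop :=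
  ∃ s : Set (Pt F), isLine F s ∧ m = s ∩ SigmaSet q F η ∧ m.ncard = q + 1

/-- `S` is a line-spread of `Σ_η`. -/
def IsSpreadOfSigma (η : F) (S : Set (Set (Pt F))) : Prop :=
  (∀ m ∈ S, IsLineOfSigma q F η m) ∧
  (∀ m ∈ S, ∀ m' ∈ S, m ≠ m' → m ∩ m' = ∅) ∧
  ⋃₀ S = SigmaSet q F η

/-- `Pl` is a parallelism of `Σ_η`. -/
def IsParallelismOfSigma (η : F) (Pl : Set (Set (Set (Pt F)))) : Prop :=
  (∀ S ∈ Pl, IsSpreadOfSigma q F η S) ∧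
  ∀ m : Set (Pt F), IsLineOfSigma q F η m → ∃! S, S ∈ Pl ∧ m ∈ S

/-- `R` is a regulus of `Σ_η`. -/
def IsRegulusOfSigma (η : F) (R : Set (Set (Pt F))) : Prop :=
  ∃ m1 m2 m3 : Set (Pt F),
    IsLineOfSigma q F η m1 ∧ IsLineOfSigma q F η m2 ∧ IsLineOfSigma q F η m3 ∧
    m1 ∩ m2 = ∅ ∧ m1 ∩ m3 = ∅ ∧ m2 ∩ m3 = ∅ ∧
    R = {m | IsLineOfSigma q F η m ∧
      (m ∩ m1).Nonempty ∧ (m ∩ m2).Nonempty ∧ (m ∩ m3).Nonempty}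

/-- `S_ℓ = { ⟨Q, τ_η(Q)⟩ ∩ Σ_η : Q ∈ ℓ }`. -/
def Sspread (η : F) (ℓ : Set (Pt F)) : Set (Set (Pt F)) :=
  {m | ∃ Q ∈ ℓ, m = lineThrough F Q (tau q F η Q) ∩ SigmaSet q F η}

/-- `R_ℓ = D_η ∩ S_ℓ`. -/
def Rreg (η : F) (ℓ : Set (Pt F)) : Set (Set (Pt F)) :=
  Dspread q F η ∩ Sspread q F η ℓ

/-- `R_ℓᵒ`: the set of lines of `Σ_η` meeting every line of `R_ℓ`. -/
def Ropp (η : F) (ℓ : Set (Pt F)) : Set (Set (Pt F)) :=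
  {m | IsLineOfSigma q F η m ∧ ∀ m' ∈ Rreg q F η ℓ, (m ∩ m').Nonempty}

/-- `G` is a good set (relative to the index set `I`). -/
def IsGoodSet (I : Set F) (G : Finset (F × F × F)) : Prop :=
  G.card = q + 1 ∧
  (∀ t ∈ G, t.1 ∈ I ∧ t.2.1 ∈ Uset q F ∧ t.2.2 ∈ Uset q F) ∧
  ∀ t ∈ G, ∀ t' ∈ G, t ≠ t' →
    t.2.1 * t'.2.2 - t'.2.1 * t.2.2 ≠ 0 ∧
    t.1 * t.2.1 * (t'.1 * t'.2.2) ^ q - (t.1 * t.2.2) ^ q * (t'.1 * t'.2.1) ≠ 0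

/-- `L_G = ⋃_{(α,u,v) ∈ G} ( p(P_{αu}, π_{αv}) \ {r_{U₁}} )`. -/
def Lset (G : Finset (F × F × F)) : Set (Set (Pt F)) :=
  ⋃ t ∈ G, (pencil q F t.1 t.2.1 t.2.2 \ {rU1 F})

/-- The putative parallelism `Π_G` associated with `G`. -/
def ParP (η : F) (G : Finset (F × F × F)) : Set (Set (Set (Pt F))) :=
  {S | ∃ ℓ ∈ Lset q F G, S = (Sspread q F η ℓ \ Rreg q F η ℓ) ∪ Ropp q F η ℓ}
    ∪ {Dspread q F η}

def gFun (b : F) (v : Fin 4 → F) : Fin 4 → F :=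
  ![v 0 + b * v 1, v 1, v 2 + b ^ q * v 3, v 3]

/-- The projectivity `g_b : (x₁,x₂,x₃,x₄) ↦ (x₁ + b x₂, x₂, x₃ + bᑫ x₄, x₄)`. -/
def gmap (b : F) (P : Pt F) : Pt F :=
  if h : gFun q F b P.rep ≠ 0 then Projectivization.mk F _ h else P

end

/-- The shear `(x₁,x₂,x₃,x₄) ↦ (x₁ + c x₂, x₂, x₃ + d x₄, x₄)` as a linear automorphism. -/
def shear {F : Type} [Field F] (c d : F) : (Fin 4 → F) ≃ₗ[F] (Fin 4 → F) where
  toFun v := ![v 0 + c * v 1, v 1, v 2 + d * v 3, v 3]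
  invFun v := ![v 0 - c * v 1, v 1, v 2 - d * v 3, v 3]
  map_add' v w := by ext i; fin_cases i <;> simp <;> ring
  map_smul' r v := by ext i; fin_cases i <;> simp <;> ring
  left_inv v := by ext i; fin_cases i <;> simp
  right_inv v := by ext i; fin_cases i <;> simp

section

variable {q : ℕ} {F : Type} [Field F]

lemma gFun_eq_shear (b : F) (v : Fin 4 → F) : gFun q F b v = shear b (b ^ q) v := rfl

lemma gFun_ne_zero (b : F) {v : Fin 4 → F} (hv : v ≠ 0) : gFun q F b v ≠ 0 := by
  rw [gFun_eq_shear]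
  exact (shear b (b ^ q)).map_ne_zero_iff.mpr hv

lemma gmap_mk (b : F) (v : Fin 4 → F) (hv : v ≠ 0) :
    gmap q F b (Projectivization.mk F v hv) = Projectivization.mk F _ (gFun_ne_zero (q := q) b hv) := by
  obtain ⟨a, ha⟩ := Projectivization.exists_smul_eq_mk_rep F v hv
  rw [gmap, dif_pos (gFun_ne_zero b (Projectivization.rep_nonzero _)),
    Projectivization.mk_eq_mk_iff]
  refine ⟨a, ?_⟩
  rw [← ha, gFun_eq_shear, gFun_eq_shear, Units.smul_def, Units.smul_def, map_smul]

lemma gmap_submodule (b : F) (P : Pt F) :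
    (gmap q F b P).submodule
      = P.submodule.map (shear b (b ^ q) : (Fin 4 → F) →ₗ[F] (Fin 4 → F)) := by
  induction P using Projectivization.ind with
  | h v hv =>
    rw [gmap_mk, Projectivization.submodule_mk, Projectivization.submodule_mk,
      Submodule.map_span, Set.image_singleton]
    rfl

lemma gmap_neg_gmap (hadd : ∀ x y : F, (x + y) ^ q = x ^ q + y ^ q) (hq : q ≠ 0)
    (b : F) (P : Pt F) : gmap q F (-b) (gmap q F b P) = P := by
  have hneg : (-b) ^ q = -b ^ q := by
    have := hadd (-b) b
    rw [neg_add_cancel, zero_pow hq] at this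
    exact eq_neg_of_add_eq_zero_left this.symm
  induction P using Projectivization.ind with
  | h v hv =>
    rw [gmap_mk, gmap_mk, Projectivization.mk_eq_mk_iff]
    refine ⟨1, ?_⟩
    rw [one_smul]
    ext i
    fin_cases i <;> simp [gFun, hneg]

lemma gmap_gmap_neg (hadd : ∀ x y : F, (x + y) ^ q = x ^ q + y ^ q) (hq : q ≠ 0)
    (b : F) (P : Pt F) : gmap q F b (gmap q F (-b) P) = P := by
  simpa using gmap_neg_gmap hadd hq (-b) P

lemma gmap_injective (hadd : ∀ x y : F, (x + y) ^ q = x ^ q + y ^ q) (hq : q ≠ 0)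
    (b : F) : Function.Injective (gmap q F b) :=
  Function.LeftInverse.injective (gmap_neg_gmap hadd hq b)

lemma gmap_image_gmap_neg_image (hadd : ∀ x y : F, (x + y) ^ q = x ^ q + y ^ q) (hq : q ≠ 0)
    (b : F) (s : Set (Pt F)) : gmap q F b '' (gmap q F (-b) '' s) = s := by
  rw [Set.image_image]
  simp [gmap_gmap_neg hadd hq]

lemma gmap_neg_image_gmap_image (hadd : ∀ x y : F, (x + y) ^ q = x ^ q + y ^ q) (hq : q ≠ 0)
    (b : F) (s : Set (Pt F)) : gmap q F (-b) '' (gmap q F b '' s) = s := by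
  simpa using gmap_image_gmap_neg_image hadd hq (-b) s

lemma gmap_image_submodule_le (hadd : ∀ x y : F, (x + y) ^ q = x ^ q + y ^ q) (hq : q ≠ 0)
    (b : F) (W : Submodule F (Fin 4 → F)) :
    gmap q F b '' {P : Pt F | P.submodule ≤ W} = {P : Pt F | P.submodule ≤
      W.map (shear b (b ^ q) : (Fin 4 → F) →ₗ[F] (Fin 4 → F))} := by
  ext P
  constructor
  · rintro ⟨Q, hQ, rfl⟩
    rw [Set.mem_ofPred_eq, gmap_submodule]
    exact Submodule.map_mono hQ
  · intro hP
    refine ⟨gmap q F (-b) P, ?_, gmap_gmap_neg hadd hq b P⟩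
    rw [← gmap_gmap_neg hadd hq b P, Set.mem_ofPred_eq, gmap_submodule] at hP
    exact (Submodule.map_le_map_iff_of_injective (shear b (b ^ q)).injective _ _).mp hP

lemma isLine.gmap_image (hadd : ∀ x y : F, (x + y) ^ q = x ^ q + y ^ q) (hq : q ≠ 0)
    (b : F) {s : Set (Pt F)} (hs : isLine F s) : isLine F (gmap q F b '' s) := by
  obtain ⟨W, hW, rfl⟩ := hs
  refine ⟨_, ?_, gmap_image_submodule_le hadd hq b W⟩
  rw [← hW]
  exact LinearEquiv.finrank_map_eq (shear b (b ^ q)) W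

lemma gmap_image_lineThrough (hadd : ∀ x y : F, (x + y) ^ q = x ^ q + y ^ q) (hq : q ≠ 0)
    (b : F) (A B : Pt F) :
    gmap q F b '' lineThrough F A B = lineThrough F (gmap q F b A) (gmap q F b B) := by
  rw [lineThrough, gmap_image_submodule_le hadd hq, Submodule.map_sup, ← gmap_submodule,
    ← gmap_submodule]
  rfl

lemma image_eq_of_forall_image_subset (hadd : ∀ x y : F, (x + y) ^ q = x ^ q + y ^ q)
    (hq : q ≠ 0) {s : Set (Pt F)} (h : ∀ b : F, gmap q F b '' s ⊆ s) (b : F) :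
    gmap q F b '' s = s := by
  refine (h b).antisymm ?_
  conv_lhs => rw [← gmap_image_gmap_neg_image hadd hq b s]
  exact Set.image_mono (h (-b))

lemma gmap_image_SigmaSet (hadd : ∀ x y : F, (x + y) ^ q = x ^ q + y ^ q) (hq : q ≠ 0)
    (α b : F) : gmap q F b '' SigmaSet q F α = SigmaSet q F α := by
  refine image_eq_of_forall_image_subset hadd hq (fun b => ?_) b
  rintro _ ⟨_, ⟨x, y, h, rfl⟩, rfl⟩
  have e : gFun q F b ![x, y, α * x ^ q, α * y ^ q]
      = ![x + b * y, y, α * (x + b * y) ^ q, α * y ^ q] := by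
    ext i
    fin_cases i <;> simp [gFun, hadd, mul_pow]
    ring
  refine ⟨x + b * y, y, e ▸ gFun_ne_zero b h, ?_⟩
  rw [gmap_mk]
  congr 1

lemma tauFun_ne_zero (hq : q ≠ 0) {α : F} (hα : α ≠ 0) {v : Fin 4 → F} (hv : v ≠ 0) :
    tauFun q F α v ≠ 0 := by
  contrapose! hv
  have h0 := congrFun hv 0
  have h1 := congrFun hv 1
  have h2 := congrFun hv 2
  have h3 := congrFun hv 3
  simp [tauFun, hα, hq] at h0 h1 h2 h3
  ext i
  fin_cases i <;> simp [*]

lemma tau_mk (hq : q ≠ 0) {α : F} (hα : α ≠ 0) (v : Fin 4 → F) (hv : v ≠ 0) :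
    tau q F α (Projectivization.mk F v hv)
      = Projectivization.mk F _ (tauFun_ne_zero hq hα hv) := by
  obtain ⟨a, ha⟩ := Projectivization.exists_smul_eq_mk_rep F v hv
  rw [tau, dif_pos (tauFun_ne_zero hq hα (Projectivization.rep_nonzero _)),
    Projectivization.mk_eq_mk_iff]
  refine ⟨a ^ q, ?_⟩
  rw [← ha]
  ext i
  fin_cases i <;> simp [tauFun, Units.smul_def, mul_pow] <;> ring

lemma gmap_tau (hadd : ∀ x y : F, (x + y) ^ q = x ^ q + y ^ q) (hfix : ∀ x : F, (x ^ q) ^ q = x)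
    (hq : q ≠ 0) {α : F} (hα : α ≠ 0) (b : F) (P : Pt F) :
    gmap q F b (tau q F α P) = tau q F α (gmap q F b P) := by
  induction P using Projectivization.ind with
  | h v hv =>
    rw [gmap_mk, tau_mk hq hα, tau_mk hq hα, gmap_mk, Projectivization.mk_eq_mk_iff]
    refine ⟨1, ?_⟩
    rw [one_smul]
    ext i
    fin_cases i <;> simp [tauFun, gFun, hadd, mul_pow, hfix]
    ring

lemma gmap_mem_t1 (b : F) {P : Pt F} (hP : P ∈ t1 F) : gmap q F b P ∈ t1 F := by
  have hP' := gmap_mk (q := q) b P.rep P.rep_nonzero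
  rw [Projectivization.mk_rep] at hP'
  obtain ⟨a, ha⟩ := Projectivization.exists_smul_eq_mk_rep F _ (gFun_ne_zero (q := q) b P.rep_nonzero)
  obtain ⟨h2, h3⟩ := hP
  rw [hP']
  constructor <;> rw [← ha] <;> simp [gFun, h2, h3]

lemma gmap_image_rU1 (hadd : ∀ x y : F, (x + y) ^ q = x ^ q + y ^ q) (hq : q ≠ 0) (b : F) :
    gmap q F b '' rU1 F = rU1 F := by
  refine image_eq_of_forall_image_subset hadd hq (fun b => ?_) b
  rintro _ ⟨P, ⟨h1, h3⟩, rfl⟩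
  have hP' := gmap_mk (q := q) b P.rep P.rep_nonzero
  rw [Projectivization.mk_rep] at hP'
  obtain ⟨a, ha⟩ := Projectivization.exists_smul_eq_mk_rep F _ (gFun_ne_zero (q := q) b P.rep_nonzero)
  rw [hP']
  constructor <;> rw [← ha] <;> simp [gFun, h1, h3]

lemma gmap_image_planeSet (hadd : ∀ x y : F, (x + y) ^ q = x ^ q + y ^ q) (hq : q ≠ 0)
    (α v b : F) : gmap q F b '' planeSet F α v = planeSet F α v := by
  refine image_eq_of_forall_image_subset hadd hq (fun b => ?_) b
  rintro _ ⟨P, h, rfl⟩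
  have hP' := gmap_mk (q := q) b P.rep P.rep_nonzero
  rw [Projectivization.mk_rep] at hP'
  obtain ⟨a, ha⟩ := Projectivization.exists_smul_eq_mk_rep F _ (gFun_ne_zero (q := q) b P.rep_nonzero)
  rw [planeSet, Set.mem_ofPred_eq] at h
  rw [hP', planeSet, Set.mem_ofPred_eq, ← ha]
  simp only [gFun, Units.smul_def, Pi.smul_apply, smul_eq_mul, Matrix.cons_val, h]
  ring

lemma gmap_Ppt (α u b : F) : gmap q F b (Ppt F α u) = Ppt F α u := by
  rw [Ppt, gmap_mk, Projectivization.mk_eq_mk_iff]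
  refine ⟨1, ?_⟩
  rw [one_smul]
  ext i
  fin_cases i <;> simp [gFun]

lemma gmap_image_mem_pencil (hadd : ∀ x y : F, (x + y) ^ q = x ^ q + y ^ q) (hq : q ≠ 0)
    (b : F) {α u v : F} {ℓ : Set (Pt F)} (h : ℓ ∈ pencil q F α u v) :
    gmap q F b '' ℓ ∈ pencil q F α u v := by
  obtain ⟨hl, hP, hpl, hc⟩ := h
  refine ⟨hl.gmap_image hadd hq b, ⟨_, hP, gmap_Ppt α u b⟩, ?_, ?_⟩
  · rw [← gmap_image_planeSet hadd hq α v b]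
    exact Set.image_mono hpl
  · rw [← gmap_image_SigmaSet hadd hq α b, ← Set.image_inter (gmap_injective hadd hq b),
      Set.ncard_image_of_injective _ (gmap_injective hadd hq b), hc]

lemma gmap_image_mem_Lset (hadd : ∀ x y : F, (x + y) ^ q = x ^ q + y ^ q) (hq : q ≠ 0)
    (b : F) {G : Finset (F × F × F)} {ℓ : Set (Pt F)} (h : ℓ ∈ Lset q F G) :
    gmap q F b '' ℓ ∈ Lset q F G := by
  simp only [Lset, Set.mem_iUnion, Set.mem_sdiff, Set.mem_singleton_iff] at h ⊢
  obtain ⟨t, ht, hp, hne⟩ := h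
  refine ⟨t, ht, gmap_image_mem_pencil hadd hq b hp, fun he => hne ?_⟩
  rw [← gmap_image_rU1 hadd hq b] at he
  exact (gmap_injective hadd hq b).image_injective he

lemma IsLineOfSigma.gmap_image (hadd : ∀ x y : F, (x + y) ^ q = x ^ q + y ^ q) (hq : q ≠ 0)
    (b : F) {η : F} {m : Set (Pt F)} (h : IsLineOfSigma q F η m) :
    IsLineOfSigma q F η (gmap q F b '' m) := by
  obtain ⟨s, hs, rfl, hc⟩ := h
  refine ⟨_, hs.gmap_image hadd hq b, ?_, ?_⟩
  · rw [Set.image_inter (gmap_injective hadd hq b), gmap_image_SigmaSet hadd hq]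
  · rw [Set.ncard_image_of_injective _ (gmap_injective hadd hq b), hc]

lemma image_gmap_Dspread (hadd : ∀ x y : F, (x + y) ^ q = x ^ q + y ^ q)
    (hfix : ∀ x : F, (x ^ q) ^ q = x) (hq : q ≠ 0) (α b : F) :
    (fun m : Set (Pt F) => gmap q F b '' m) '' Dspread q F α = Dspread q F α := by
  have key : ∀ c : F, ∀ m ∈ Dspread q F α, gmap q F c '' m ∈ Dspread q F α := by
    rintro c _ ⟨P, hP, rfl⟩
    refine ⟨gmap q F c P, gmap_mem_t1 c hP, ?_⟩
    rw [Set.image_inter (gmap_injective hadd hq c), gmap_image_SigmaSet hadd hq, rLine,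
      gmap_image_lineThrough hadd hq, gmap_tau hadd hfix hq one_ne_zero, rLine]
  refine Set.Subset.antisymm ?_ fun m hm =>
    ⟨_, key (-b) m hm, gmap_image_gmap_neg_image hadd hq b m⟩
  rintro _ ⟨m, hm, rfl⟩
  exact key b m hm

lemma image_gmap_Sspread (hadd : ∀ x y : F, (x + y) ^ q = x ^ q + y ^ q)
    (hfix : ∀ x : F, (x ^ q) ^ q = x) (hq : q ≠ 0) {η : F} (hη : η ≠ 0) (b : F)
    (ℓ : Set (Pt F)) :
    (fun m : Set (Pt F) => gmap q F b '' m) '' Sspread q F η ℓ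
      = Sspread q F η (gmap q F b '' ℓ) := by
  have key : ∀ Q : Pt F, gmap q F b '' (lineThrough F Q (tau q F η Q) ∩ SigmaSet q F η)
      = lineThrough F (gmap q F b Q) (tau q F η (gmap q F b Q)) ∩ SigmaSet q F η := fun Q => by
    rw [Set.image_inter (gmap_injective hadd hq b), gmap_image_SigmaSet hadd hq,
      gmap_image_lineThrough hadd hq, gmap_tau hadd hfix hq hη]
  ext m
  constructor
  · rintro ⟨_, ⟨Q, hQ, rfl⟩, rfl⟩
    exact ⟨_, ⟨Q, hQ, rfl⟩, key Q⟩
  · rintro ⟨_, ⟨Q, hQ, rfl⟩, rfl⟩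
    exact ⟨_, ⟨Q, hQ, rfl⟩, key Q⟩

lemma image_gmap_Rreg (hadd : ∀ x y : F, (x + y) ^ q = x ^ q + y ^ q)
    (hfix : ∀ x : F, (x ^ q) ^ q = x) (hq : q ≠ 0) {η : F} (hη : η ≠ 0) (b : F)
    (ℓ : Set (Pt F)) :
    (fun m : Set (Pt F) => gmap q F b '' m) '' Rreg q F η ℓ
      = Rreg q F η (gmap q F b '' ℓ) := by
  rw [Rreg, Set.image_inter (gmap_injective hadd hq b).image_injective,
    image_gmap_Dspread hadd hfix hq, image_gmap_Sspread hadd hfix hq hη, Rreg]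

lemma image_gmap_Ropp (hadd : ∀ x y : F, (x + y) ^ q = x ^ q + y ^ q)
    (hfix : ∀ x : F, (x ^ q) ^ q = x) (hq : q ≠ 0) {η : F} (hη : η ≠ 0) (b : F)
    (ℓ : Set (Pt F)) :
    (fun m : Set (Pt F) => gmap q F b '' m) '' Ropp q F η ℓ
      = Ropp q F η (gmap q F b '' ℓ) := by
  have key : ∀ (c : F) (k : Set (Pt F)), ∀ m ∈ Ropp q F η k,
      gmap q F c '' m ∈ Ropp q F η (gmap q F c '' k) := by
    rintro c k m ⟨hm, hmeet⟩
    refine ⟨hm.gmap_image hadd hq c, ?_⟩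
    rw [← image_gmap_Rreg hadd hfix hq hη]
    rintro _ ⟨m', hm', rfl⟩
    rw [← Set.image_inter (gmap_injective hadd hq c)]
    exact (hmeet m' hm').image _
  refine Set.Subset.antisymm ?_ fun m hm =>
    ⟨gmap q F (-b) '' m, ?_, gmap_image_gmap_neg_image hadd hq b m⟩
  · rintro _ ⟨m, hm, rfl⟩
    exact key b ℓ m hm
  · simpa only [gmap_neg_image_gmap_image hadd hq] using key (-b) _ m hm

lemma image_gmap_mem_ParP (hadd : ∀ x y : F, (x + y) ^ q = x ^ q + y ^ q)
    (hfix : ∀ x : F, (x ^ q) ^ q = x) (hq : q ≠ 0) {η : F} (hη : η ≠ 0) (b : F)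
    {G : Finset (F × F × F)} {S : Set (Set (Pt F))} (hS : S ∈ ParP q F η G) :
    (fun m : Set (Pt F) => gmap q F b '' m) '' S ∈ ParP q F η G := by
  obtain ⟨ℓ, hℓ, rfl⟩ | rfl := hS
  · refine Or.inl ⟨_, gmap_image_mem_Lset hadd hq b hℓ, ?_⟩
    rw [Set.image_union, Set.image_sdiff (gmap_injective hadd hq b).image_injective,
      image_gmap_Sspread hadd hfix hq hη, image_gmap_Rreg hadd hfix hq hη,
      image_gmap_Ropp hadd hfix hq hη]
  · exact Or.inr (image_gmap_Dspread hadd hfix hq _ b)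

lemma add_pow_of_card_eq_sq [Fintype F] (hq : IsPrimePow q) (hF : Fintype.card F = q ^ 2)
    (x y : F) : (x + y) ^ q = x ^ q + y ^ q := by
  obtain ⟨p, k, hp, hk, rfl⟩ := hq
  obtain ⟨r, hr⟩ := CharP.exists F
  obtain ⟨n, hrp, hn⟩ := FiniteField.card F r
  have hpr : p = r := by
    refine (Nat.prime_dvd_prime_iff_eq hp.nat_prime hrp).mp (hp.nat_prime.dvd_of_dvd_pow (n := n) ?_)
    rw [← hn, hF]
    exact dvd_pow (dvd_pow_self p hk.ne') two_ne_zero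
  subst hpr
  have := Fact.mk hrp
  exact add_pow_char_pow x y p k

end

/-- Every projectivity `g_b` leaves the parallelism `Π_G` invariant. -/
theorem statement10 (q : ℕ) (hq : IsPrimePow q) (hq3 : 3 ≤ q) (F : Type) [Field F] [Fintype F]
    (hF : Fintype.card F = q ^ 2) (I : Set F) (hI : IsIndexSet q F I)
    (η : F) (hηU : η ^ (q + 1) = 1)
    (G : Finset (F × F × F)) (hG : IsGoodSet q F I G) (b : F) :
    (fun S : Set (Set (Pt F)) => (fun m : Set (Pt F) => gmap q F b '' m) '' S) '' ParP q F η G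
      = ParP q F η G := by
  have hadd := add_pow_of_card_eq_sq hq hF
  have hfix : ∀ x : F, (x ^ q) ^ q = x := fun x => by
    rw [← pow_mul, ← sq, ← hF, FiniteField.pow_card]
  have hq0 : q ≠ 0 := by omega
  have hη : η ≠ 0 := by
    rintro rfl
    simp at hηU
  refine Set.Subset.antisymm ?_ fun S hS =>
    ⟨_, image_gmap_mem_ParP hadd hfix hq0 hη (-b) hS, ?_⟩
  · rintro _ ⟨S, hS, rfl⟩
    exact image_gmap_mem_ParP hadd hfix hq0 hη b hS
  · simp only [Set.image_image, gmap_gmap_neg hadd hq0, Set.image_id']
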